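/- Let (Y,d_Y) be a CAT(1) space, o ∈ Y, and ρ ∈ (0,π/2). There is a constant c_ρ > 0 depending only on ρ such that: for all points a, b, a', b' in the closed ball B̄_ρ(o) with d_Y(a,a') < 2(π−2ρ) and d_Y(b,b') < 2(π−2ρ), the midpoints m of a,b and m' of a',b' satisfy d_Y(m,m') ≤ c_ρ·(d_Y(a,a') + d_Y(b,b')). -/

import Mathlib

open MeasureTheory Metric Filter Topology Set
open scoped ENNReal NNReal

noncomputable section

namespace KSH

attribute [local instance] Classical.propDecidable

variable {X Y : Type*}

/-! ### Metric measure space basics -/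

/-- The measure is finite on bounded sets. -/
def FiniteOnBounded [PseudoMetricSpace X] [MeasurableSpace X] (m : Measure X) : Prop :=
  ∀ s : Set X, Bornology.IsBounded s → m s < ⊤

/-- Locally uniformly doubling measure. -/
def LocUnifDoubling [PseudoMetricSpace X] [MeasurableSpace X] (m : Measure X) : Prop :=
  ∀ R : ℝ, 0 < R → ∃ C : ℝ≥0, 0 < C ∧
    ∀ (x : X) (r : ℝ), 0 < r → r < R →
      m (Metric.ball x (2 * r)) ≤ (C : ℝ≥0∞) * m (Metric.ball x r)

/-- Pointwise Lipschitz constant (`ℝ≥0∞`-valued); it equals `0` at isolated points. -/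
def elip [PseudoEMetricSpace X] [PseudoEMetricSpace Y] (f : X → Y) (x : X) : ℝ≥0∞ :=
  Filter.limsup (fun y => edist (f x) (f y) / edist x y) (𝓝[≠] x)

/-- A (local, uniform) Poincaré inequality. -/
def PoincareIneq [PseudoMetricSpace X] [MeasurableSpace X] (m : Measure X) : Prop :=
  ∀ R : ℝ, 0 < R → ∃ C : ℝ, 0 < C ∧ ∃ lam : ℝ, 0 < lam ∧
    ∀ f : X → ℝ, (∃ K : ℝ≥0, LipschitzWith K f) →
      ∀ (x : X) (r : ℝ), 0 < r → r < R →
        (⨍ y in Metric.ball x r, |f y - ⨍ z in Metric.ball x r, f z ∂m| ∂m) ≤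
          C * r * ⨍ y in Metric.ball x (lam * r), (elip f y).toReal ∂m

/-- `d`-dimensional strongly rectifiable space. -/
def StronglyRectifiable [MetricSpace X] [MeasurableSpace X] (m : Measure X) (d : ℕ) : Prop :=
  ∀ ε : ℝ, 0 < ε →
    ∃ (U : ℕ → Set X) (φ : ℕ → X → EuclideanSpace ℝ (Fin d)) (c : ℕ → ℝ≥0),
      (∀ i, MeasurableSet (U i)) ∧
      Pairwise (Function.onFun Disjoint U) ∧
      m (Set.univ \ ⋃ i, U i) = 0 ∧
      ∀ i, 0 < c i ∧ Measurable (φ i) ∧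
        (∀ x ∈ U i, ∀ y ∈ U i,
          dist x y ≤ (1 + ε) * dist (φ i x) (φ i y) ∧
          dist (φ i x) (φ i y) ≤ (1 + ε) * dist x y) ∧
        ((c i : ℝ≥0∞) • MeasureTheory.volume.restrict (φ i '' U i) ≤
            Measure.map (φ i) (m.restrict (U i))) ∧
        Measure.map (φ i) (m.restrict (U i)) ≤
          (ENNReal.ofReal (1 + ε) * (c i : ℝ≥0∞)) • MeasureTheory.volume.restrict (φ i '' U i)

/-! ### Test plans, weak upper gradients, Sobolev spaces -/

/-- `S` is an upper speed for the curve `γ` on `[0,1]`. -/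
def UpperSpeed [PseudoMetricSpace X] (γ : ℝ → X) (S : ℝ → ℝ) : Prop :=
  ∀ s t : ℝ, 0 ≤ s → s ≤ t → t ≤ 1 → dist (γ s) (γ t) ≤ ∫ r in s..t, S r

/-- `π` is a test plan with (upper bound for the) speed given by `S`. -/
def IsTestPlan [PseudoMetricSpace X] [MeasurableSpace X] (m : Measure X)
    (π : Measure (ℝ → X)) (S : (ℝ → X) → ℝ → ℝ) : Prop :=
  IsProbabilityMeasure π ∧
  (∀ᵐ γ ∂π, ContinuousOn γ (Set.Icc 0 1)) ∧
  (∃ C : ℝ≥0, 0 < C ∧ ∀ t ∈ Set.Icc (0:ℝ) 1,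
      Measure.map (fun γ => γ t) π ≤ (C : ℝ≥0∞) • m) ∧
  (∀ᵐ γ ∂π, UpperSpeed γ (S γ)) ∧
  (∫⁻ γ, (∫⁻ t in Set.Icc (0:ℝ) 1, ENNReal.ofReal ((S γ t) ^ 2)) ∂π) < ⊤

/-- `G` is a ($2$-)weak upper gradient of `f`. -/
def IsWUG [PseudoMetricSpace X] [MeasurableSpace X] (m : Measure X) (f G : X → ℝ) : Prop :=
  Measurable G ∧ (∀ x, 0 ≤ G x) ∧ (∫⁻ x, ENNReal.ofReal ((G x) ^ 2) ∂m) < ⊤ ∧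
  ∀ (π : Measure (ℝ → X)) (S : (ℝ → X) → ℝ → ℝ), IsTestPlan m π S →
    (∫⁻ γ, ENNReal.ofReal |f (γ 1) - f (γ 0)| ∂π) ≤
      ∫⁻ γ, (∫⁻ t in Set.Icc (0:ℝ) 1, ENNReal.ofReal (G (γ t) * S γ t)) ∂π

/-- Membership in the Sobolev space `W^{1,2}`. -/
def MemW12 [PseudoMetricSpace X] [MeasurableSpace X] (m : Measure X) (f : X → ℝ) : Prop :=
  Measurable f ∧ (∫⁻ x, ENNReal.ofReal ((f x) ^ 2) ∂m) < ⊤ ∧ ∃ G, IsWUG m f G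

/-- `G` is the minimal weak upper gradient of `f`. -/
def IsMinimalWUG [PseudoMetricSpace X] [MeasurableSpace X] (m : Measure X) (f G : X → ℝ) :
    Prop :=
  IsWUG m f G ∧ ∀ G', IsWUG m f G' → ∀ᵐ x ∂m, G x ≤ G' x

/-- Square of the `W^{1,2}` norm: `∫ f² + ∫ |Df|²` (the latter as infimum over
weak upper gradients). -/
def W12Norm2 [PseudoMetricSpace X] [MeasurableSpace X] (m : Measure X) (f : X → ℝ) : ℝ≥0∞ :=
  (∫⁻ x, ENNReal.ofReal ((f x) ^ 2) ∂m) +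
    ⨅ G : {G : X → ℝ // IsWUG m f G}, ∫⁻ x, ENNReal.ofReal ((G.1 x) ^ 2) ∂m

/-- Infinitesimal Hilbertianity: the `W^{1,2}` norm satisfies the parallelogram identity. -/
def InfHilbertian [PseudoMetricSpace X] [MeasurableSpace X] (m : Measure X) : Prop :=
  ∀ f g : X → ℝ, MemW12 m f → MemW12 m g →
    W12Norm2 m (f + g) + W12Norm2 m (f - g) = 2 * W12Norm2 m f + 2 * W12Norm2 m g

/-- The restriction of a function to a subset, as a function on the subtype. -/
def restrFun (Ω : Set X) (f : X → ℝ) : Ω → ℝ := fun x => f x.1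

/-- The measure induced on a subset. -/
def subMeasure [MeasurableSpace X] (m : Measure X) (Ω : Set X) : Measure Ω :=
  Measure.comap Subtype.val m

/-- Membership in `W^{1,2}(Ω)`. -/
def MemW12On [MetricSpace X] [MeasurableSpace X] (m : Measure X) (Ω : Set X) (f : X → ℝ) :
    Prop :=
  MemW12 (subMeasure m Ω) (restrFun Ω f)

/-- Squared `W^{1,2}(Ω)`-distance between two functions. -/
def W12DistSq [MetricSpace X] [MeasurableSpace X] (m : Measure X) (Ω : Set X) (f g : X → ℝ) :
    ℝ≥0∞ :=
  W12Norm2 (subMeasure m Ω) (restrFun Ω f - restrFun Ω g)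

/-- Membership in `W^{1,2}_0(Ω)`: the `W^{1,2}(Ω)`-closure of Sobolev functions with
support contained in `Ω`. -/
def MemW120 [MetricSpace X] [MeasurableSpace X] (m : Measure X) (Ω : Set X) (f : X → ℝ) :
    Prop :=
  MemW12On m Ω f ∧ ∀ ε : ℝ≥0∞, 0 < ε → ∃ g : X → ℝ,
    MemW12On m Ω g ∧ closure (Function.support g) ⊆ Ω ∧ W12DistSq m Ω f g < ε

/-! ### Korevaar–Schoen energies -/

/-- Borel measurability of a map. -/
def BorelMeas [MeasurableSpace X] [TopologicalSpace Y] (u : X → Y) : Prop :=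
  ∀ s : Set Y, IsOpen s → MeasurableSet (u ⁻¹' s)

section KS

variable [MetricSpace X] [MeasurableSpace X] [PseudoMetricSpace Y]

/-- The approximate energy `ks_{2,r}[u,Ω]`. -/
def ks2r (m : Measure X) (Ω : Set X) (u : X → Y) (r : ℝ) (x : X) : ℝ :=
  if Metric.ball x r ⊆ Ω then
    Real.sqrt (⨍ y in Metric.ball x r, dist (u x) (u y) ^ 2 / r ^ 2 ∂m)
  else 0

/-- The squared approximate energy, `ℝ≥0∞`-valued. -/
def eks2r (m : Measure X) (Ω : Set X) (u : X → Y) (r : ℝ) (x : X) : ℝ≥0∞ :=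
  if Metric.ball x r ⊆ Ω then
    (m (Metric.ball x r))⁻¹ *
      ∫⁻ y in Metric.ball x r, (edist (u x) (u y)) ^ 2 / (ENNReal.ofReal r) ^ 2 ∂m
  else 0

/-- The set `Ω_{v,w,α,x}` of points where `v` or `w` moves at least `α` away from its
value at `x`. -/
def badSet (Ω : Set X) (v w : X → Y) (α : ℝ) (x : X) : Set X :=
  {y ∈ Ω | α ≤ dist (v x) (v y) ∨ α ≤ dist (w x) (w y)}

/-- The modified approximate energy `ks_{2,r}[u,Ω;v,w,α]`. -/
def ks2rMod (m : Measure X) (Ω : Set X) (u v w : X → Y) (α : ℝ) (r : ℝ) (x : X) : ℝ :=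
  if Metric.ball x r ⊆ Ω then
    Real.sqrt ((m (Metric.ball x r)).toReal⁻¹ *
      ∫ y in Metric.ball x r \ badSet Ω v w α x, dist (u x) (u y) ^ 2 / r ^ 2 ∂m)
  else 0

/-- Membership in `L²(Ω, Y_o)`. -/
def MemL2 (m : Measure X) (Ω : Set X) (o : Y) (u : X → Y) : Prop :=
  BorelMeas u ∧ TopologicalSpace.IsSeparable (u '' Ω) ∧
    (∫⁻ x in Ω, ENNReal.ofReal (dist (u x) o ^ 2) ∂m) < ⊤

/-- The Korevaar–Schoen energy `E_2^Ω(u)`. -/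
def ksEnergy (m : Measure X) (Ω : Set X) (u : X → Y) : ℝ≥0∞ :=
  Filter.liminf (fun r : ℝ => ∫⁻ x in Ω, ENNReal.ofReal ((ks2r m Ω u r x) ^ 2) ∂m)
    (𝓝[>] (0:ℝ))

/-- Membership in the Korevaar–Schoen space `KS^{1,2}(Ω, Y_o)`. -/
def MemKS (m : Measure X) (Ω : Set X) (o : Y) (u : X → Y) : Prop :=
  MemL2 m Ω o u ∧ ksEnergy m Ω u < ⊤

/-- `e` is the energy density `e_2[u]` of `u`: the approximate energies converge to it
`m`-a.e. on `Ω` and in `L²(Ω)` as `r ↓ 0`. -/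
def IsEnergyDensity (m : Measure X) (Ω : Set X) (u : X → Y) (e : X → ℝ) : Prop :=
  (∀ᵐ x ∂m.restrict Ω,
    Filter.Tendsto (fun r => ks2r m Ω u r x) (𝓝[>] (0:ℝ)) (𝓝 (e x))) ∧
  Filter.Tendsto (fun r => ∫⁻ x in Ω, ENNReal.ofReal ((ks2r m Ω u r x - e x) ^ 2) ∂m)
    (𝓝[>] (0:ℝ)) (𝓝 0)

/-- The `L²(Ω)`-distance between two maps. -/
def dL2 (m : Measure X) (Ω : Set X) (u v : X → Y) : ℝ≥0∞ :=
  (∫⁻ x in Ω, (edist (u x) (v x)) ^ 2 ∂m) ^ (1/2 : ℝ)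

end KS

/-! ### Geodesics and CAT(κ) spaces -/

/-- A geodesic parametrized (proportionally to arc length) on `[0,1]`. -/
def IsGeodesic [PseudoMetricSpace Y] (γ : ℝ → Y) : Prop :=
  ∀ s ∈ Set.Icc (0:ℝ) 1, ∀ t ∈ Set.Icc (0:ℝ) 1,
    dist (γ s) (γ t) = |s - t| * dist (γ 0) (γ 1)

/-- Every pair of points is joined by a geodesic. -/
def GeodesicSpace (Y : Type*) [PseudoMetricSpace Y] : Prop :=
  ∀ x y : Y, ∃ γ : ℝ → Y, IsGeodesic γ ∧ γ 0 = x ∧ γ 1 = y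

/-- Diameter `D_κ` of the model space `M_κ`. -/
def modelDiam (κ : ℝ) : ℝ≥0∞ :=
  if 0 < κ then ENNReal.ofReal (Real.pi / Real.sqrt κ) else ⊤

/-- Inverse hyperbolic cosine. -/
def arcosh (x : ℝ) : ℝ := Real.log (x + Real.sqrt (x ^ 2 - 1))

/-- Cosine of the angle at the vertex between the sides of lengths `a` and `c` of a
comparison triangle in `M_κ` with side lengths `a`, `b`, `c` (`b` being the side
opposite to the vertex), from the law of cosines in `M_κ`. -/
def modelCosAngle (κ a b c : ℝ) : ℝ :=
  if 0 < κ then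
    (Real.cos (Real.sqrt κ * b) - Real.cos (Real.sqrt κ * a) * Real.cos (Real.sqrt κ * c)) /
      (Real.sin (Real.sqrt κ * a) * Real.sin (Real.sqrt κ * c))
  else if κ = 0 then (a ^ 2 + c ^ 2 - b ^ 2) / (2 * a * c)
  else
    (Real.cosh (Real.sqrt (-κ) * a) * Real.cosh (Real.sqrt (-κ) * c) -
        Real.cosh (Real.sqrt (-κ) * b)) /
      (Real.sinh (Real.sqrt (-κ) * a) * Real.sinh (Real.sqrt (-κ) * c))

/-- In a comparison triangle `p̄ q̄ r̄` in `M_κ` with `d(p̄,q̄) = a`, `d(p̄,r̄) = b`,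
`d(q̄,r̄) = c`, the distance from `p̄` to the point on the side `q̄ r̄` at arc length `s`
from `q̄`. -/
def modelDist (κ a b c s : ℝ) : ℝ :=
  if 0 < κ then
    (1 / Real.sqrt κ) *
      Real.arccos (Real.cos (Real.sqrt κ * a) * Real.cos (Real.sqrt κ * s) +
        Real.sin (Real.sqrt κ * a) * Real.sin (Real.sqrt κ * s) * modelCosAngle κ a b c)
  else if κ = 0 then
    Real.sqrt (a ^ 2 + s ^ 2 - 2 * a * s * modelCosAngle κ a b c)
  else
    (1 / Real.sqrt (-κ)) *
      arcosh (Real.cosh (Real.sqrt (-κ) * a) * Real.cosh (Real.sqrt (-κ) * s) -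
        Real.sinh (Real.sqrt (-κ) * a) * Real.sinh (Real.sqrt (-κ) * s) * modelCosAngle κ a b c)

/-- `Y` is a CAT(κ) space: a complete geodesic space in which every (nondegenerate)
geodesic triangle of perimeter `< 2 D_κ` is at least as thin as its comparison triangle
in the model space `M_κ`. -/
def IsCAT (κ : ℝ) (Y : Type*) [MetricSpace Y] : Prop :=
  GeodesicSpace Y ∧
  ∀ (p : Y) (γ : ℝ → Y), IsGeodesic γ →
    0 < dist p (γ 0) → 0 < dist (γ 0) (γ 1) →
    ENNReal.ofReal (dist p (γ 0) + dist p (γ 1) + dist (γ 0) (γ 1)) < 2 * modelDiam κ →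
    ∀ t ∈ Set.Icc (0:ℝ) 1,
      dist p (γ t) ≤
        modelDist κ (dist p (γ 0)) (dist p (γ 1)) (dist (γ 0) (γ 1))
          (t * dist (γ 0) (γ 1))

/-- `mid` is the midpoint of a geodesic from `a` to `b`. -/
def IsGeodMidpoint [PseudoMetricSpace Y] (a b mid : Y) : Prop :=
  ∃ γ : ℝ → Y, IsGeodesic γ ∧ γ 0 = a ∧ γ 1 = b ∧ γ (1/2) = mid

/-- `p` is the point at parameter `t` on a geodesic from `a` to `b`. -/
def IsGeodInterp [PseudoMetricSpace Y] (a b : Y) (t : ℝ) (p : Y) : Prop :=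
  ∃ γ : ℝ → Y, IsGeodesic γ ∧ γ 0 = a ∧ γ 1 = b ∧ γ t = p

/-! ### The Dirichlet energy functional -/

/-- `u` belongs to `KS^{1,2}_{ū}(Ω, T)`: a Korevaar–Schoen map with values in `T`
whose "boundary value" agrees with that of `ū`. -/
def KSuSetIn [MetricSpace X] [MeasurableSpace X] [PseudoMetricSpace Y]
    (m : Measure X) (Ω : Set X) (o : Y) (T : Set Y) (ubar u : X → Y) : Prop :=
  (∀ x ∈ Ω, u x ∈ T) ∧ MemKS m Ω o u ∧
    MemW120 m Ω (fun x => dist (u x) (ubar x))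

/-- The functional `E^Ω_{2,ū}` (equal to the energy on `KS^{1,2}_{ū}` and `+∞` elsewhere). -/
def EFunIn [MetricSpace X] [MeasurableSpace X] [PseudoMetricSpace Y]
    (m : Measure X) (Ω : Set X) (o : Y) (T : Set Y) (ubar u : X → Y) : ℝ≥0∞ :=
  if KSuSetIn m Ω o T ubar u then ksEnergy m Ω u else ⊤


theorem IsGeodMidpoint.symm' {Y : Type*} [PseudoMetricSpace Y] {a b m : Y}
    (h : IsGeodMidpoint a b m) : IsGeodMidpoint b a m := by
  obtain ⟨γ, hγ, h0, h1, hm⟩ := h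
  refine ⟨fun t => γ (1 - t), ?_, by simpa using h1, by simpa using h0, ?_⟩
  · intro s hs t ht
    have := hγ (1 - s) ⟨by linarith [hs.2], by linarith [hs.1]⟩ (1 - t)
      ⟨by linarith [ht.2], by linarith [ht.1]⟩
    simp only [this, sub_zero, sub_self]
    rw [dist_comm (γ 1), show (1 - s - (1 - t)) = t - s by ring, abs_sub_comm]
  · rw [← hm]; norm_num

theorem IsGeodMidpoint.dist_left' {Y : Type*} [PseudoMetricSpace Y] {a b m : Y}
    (h : IsGeodMidpoint a b m) : dist a m = dist a b / 2 := by
  obtain ⟨γ, hγ, h0, h1, hm⟩ := h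
  have := hγ 0 (by simp) (1/2) (by norm_num)
  rw [h0, h1, hm] at this
  rw [this]; norm_num [abs_of_pos]; ring

/-- Midpoint comparison. -/
theorem mid_comparison {Y : Type*} [MetricSpace Y] (hY : IsCAT 1 Y) {p q r m : Y}
    (h : IsGeodMidpoint q r m)
    (hper : dist p q + dist p r + dist q r < 2 * Real.pi) :
    Real.cos (dist p q) + Real.cos (dist p r) ≤
      2 * Real.cos (dist q r / 2) * Real.cos (dist p m) := by
  have hql := h.dist_left'
  have hd2 : Real.cos (dist q r) = 2 * Real.cos (dist q r / 2) ^ 2 - 1 := by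
    rw [← Real.cos_two_mul]; congr 1; ring
  rcases eq_or_ne p q with rfl | hpq
  · rw [hql, dist_self, Real.cos_zero, hd2]; apply le_of_eq; ring
  rcases eq_or_ne q r with rfl | hqr
  · rw [dist_self, zero_div, dist_eq_zero] at hql
    subst hql
    simp; linarith
  have t1 := dist_triangle p q r
  have t2 := dist_triangle q p r
  have t3 := dist_triangle p r q
  rw [dist_comm q p] at t2
  rw [dist_comm r q] at t3
  have hpos : 0 < dist p q := dist_pos.2 hpq
  have hpos2 : 0 < dist q r := dist_pos.2 hqr
  have hpr := dist_nonneg (x := p) (y := r)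
  obtain ⟨γ, hγ, h0, h1, hm⟩ := h
  have key := hY.2 p γ hγ (by rwa [h0]) (by rwa [h0, h1]) (by
    rw [h0, h1]
    simp only [modelDiam, zero_lt_one, if_true, Real.sqrt_one, div_one]
    rw [show (2 : ℝ≥0∞) = ENNReal.ofReal 2 by simp,
      ← ENNReal.ofReal_mul (by norm_num)]
    exact (ENNReal.ofReal_lt_ofReal_iff (by positivity)).2 hper) (1/2) (by norm_num)
  rw [h0, h1, hm] at key
  simp only [modelDist, modelCosAngle, zero_lt_one, if_true, Real.sqrt_one, div_one, one_mul]
    at key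
  rw [show 1 / 2 * dist q r = dist q r / 2 by ring] at key
  generalize dist p q = x at *
  generalize dist p r = y at *
  generalize dist q r = z at *
  generalize hd : dist p m = d at *
  have hd0 : 0 ≤ d := hd ▸ dist_nonneg
  have hc : 0 < Real.cos (z / 2) := Real.cos_pos_of_mem_Ioo ⟨by linarith, by linarith⟩
  have hs : 0 < Real.sin (z / 2) := Real.sin_pos_of_pos_of_lt_pi (by linarith) (by linarith)
  have hsx : 0 < Real.sin x := Real.sin_pos_of_pos_of_lt_pi (by linarith) (by linarith)
  have hsz : Real.sin z = 2 * Real.sin (z / 2) * Real.cos (z / 2) := by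
    rw [← Real.sin_two_mul]; congr 1; ring
  have hu : Real.cos x * Real.cos (z / 2) + Real.sin x * Real.sin (z / 2) *
      ((Real.cos y - Real.cos x * Real.cos z) / (Real.sin x * Real.sin z)) =
      (Real.cos x + Real.cos y) / (2 * Real.cos (z / 2)) := by
    rw [hsz, hd2]; field_simp; ring
  rw [hu] at key
  have hle : (Real.cos x + Real.cos y) / (2 * Real.cos (z / 2)) ≤ 1 := by
    rw [div_le_one (by positivity), Real.cos_add_cos]
    have e1 : Real.cos ((x + y) / 2) ≤ Real.cos (z / 2) :=
      Real.cos_le_cos_of_nonneg_of_le_pi (by linarith) (by linarith) (by linarith)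
    have e2 : 0 ≤ Real.cos ((x - y) / 2) :=
      Real.cos_nonneg_of_mem_Icc ⟨by linarith, by linarith⟩
    have e3 := Real.cos_le_one ((x - y) / 2)
    nlinarith
  have hcos := Real.cos_le_cos_of_nonneg_of_le_pi hd0 (Real.arccos_le_pi _) key
  have : (Real.cos x + Real.cos y) / (2 * Real.cos (z / 2)) ≤ Real.cos d := by
    rcases le_total (-1) ((Real.cos x + Real.cos y) / (2 * Real.cos (z / 2))) with h' | h'
    · rwa [Real.cos_arccos h' hle] at hcos
    · exact h'.trans (Real.neg_one_le_cos d)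
  rw [div_le_iff₀ (by positivity)] at this
  linarith

theorem mid_lip {Y : Type*} [MetricSpace Y] (hY : IsCAT 1 Y) {ρ : ℝ}
    (hρ : ρ ∈ Set.Ioo 0 (Real.pi / 2)) {a a' b m n : Y}
    (hab : dist b a ≤ 2 * ρ) (hab' : dist b a' ≤ 2 * ρ)
    (haa : dist a a' < 2 * (Real.pi - 2 * ρ))
    (hm : IsGeodMidpoint b a m) (hn : IsGeodMidpoint b a' n) :
    dist m n ≤ Real.pi / (4 * Real.cos ρ) * dist a a' := by
  obtain ⟨h0, h1⟩ := hρ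
  have hcr : 0 < Real.cos ρ := Real.cos_pos_of_mem_Ioo ⟨by linarith, by linarith⟩
  have k1 := mid_comparison hY (p := a') hm (by
    rw [dist_comm a' b, dist_comm a' a]; linarith)
  have hbm := hm.dist_left'
  have ham := hm.symm'.dist_left'
  have hbn := hn.dist_left'
  have han := hn.symm'.dist_left'
  have t1 := dist_triangle m a a'
  rw [dist_comm m a, ham, dist_comm a b] at t1
  have k2 := mid_comparison hY (p := m) hn (by
    rw [dist_comm m b, hbm]; linarith)
  have t2 := dist_triangle m b n
  rw [dist_comm m b, hbm, hbn] at t2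
  rw [dist_comm m b, hbm, dist_comm m a'] at k2
  rw [dist_comm a' b, dist_comm a' a] at k1
  have hx0 := dist_nonneg (x := b) (y := a)
  have hy0 := dist_nonneg (x := b) (y := a')
  have hz0 := dist_nonneg (x := a) (y := a')
  have hd0 := dist_nonneg (x := m) (y := n)
  generalize dist b a = x at *
  generalize dist b a' = y at *
  generalize dist a a' = z at *
  generalize dist m n = d at *
  generalize dist a' m = w at *
  have hy2 : Real.cos y = 2 * Real.cos (y / 2) ^ 2 - 1 := by
    rw [← Real.cos_two_mul]; congr 1; ring
  have hz2 : Real.cos z = 1 - 2 * Real.sin (z / 2) ^ 2 := by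
    have := Real.cos_sq' (z / 2); have h3 := Real.cos_two_mul (z / 2)
    rw [show 2 * (z / 2) = z by ring] at h3; linarith
  have hd2 : Real.cos d = 1 - 2 * Real.sin (d / 2) ^ 2 := by
    have := Real.cos_sq' (d / 2); have h3 := Real.cos_two_mul (d / 2)
    rw [show 2 * (d / 2) = d by ring] at h3; linarith
  have cx : Real.cos ρ ≤ Real.cos (x / 2) :=
    Real.cos_le_cos_of_nonneg_of_le_pi (by linarith) (by linarith) (by linarith)
  have cy : Real.cos ρ ≤ Real.cos (y / 2) :=
    Real.cos_le_cos_of_nonneg_of_le_pi (by linarith) (by linarith) (by linarith)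
  have js : 2 / Real.pi * (d / 2) ≤ Real.sin (d / 2) :=
    Real.mul_le_sin (by linarith) (by linarith)
  have jz : Real.sin (z / 2) ≤ z / 2 := Real.sin_le (by linarith)
  have jz0 : 0 ≤ Real.sin (z / 2) :=
    Real.sin_nonneg_of_nonneg_of_le_pi (by linarith) (by linarith)
  have jd0 : 0 ≤ Real.sin (d / 2) :=
    Real.sin_nonneg_of_nonneg_of_le_pi (by linarith) (by linarith)
  rw [hy2, hz2] at k1
  rw [hd2] at k2
  generalize Real.cos (x / 2) = c at *
  generalize Real.cos (y / 2) = c' at *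
  generalize Real.sin (d / 2) = S at *
  generalize Real.sin (z / 2) = T at *
  generalize Real.cos ρ = r at *
  have main : (2 * r * S) ^ 2 ≤ T ^ 2 := by
    have h1 : 2 * c * (c + Real.cos w) ≤ 2 * c * (2 * c' * (1 - 2 * S ^ 2)) :=
      mul_le_mul_of_nonneg_left k2 (by linarith)
    have h2 : r * r ≤ c * c' := mul_le_mul cx cy hcr.le (by linarith)
    have h3 : r * r * S ^ 2 ≤ c * c' * S ^ 2 := mul_le_mul_of_nonneg_right h2 (sq_nonneg S)
    nlinarith [sq_nonneg (c - c')]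
  have main2 : 2 * r * S ≤ T := (le_abs_self _).trans (abs_le_of_sq_le_sq main jz0)
  have hpi := Real.pi_pos
  have js' : d ≤ Real.pi * S := by
    have : 2 / Real.pi * (d / 2) = d / Real.pi := by field_simp
    rw [this, div_le_iff₀ hpi] at js
    linarith
  rw [div_mul_eq_mul_div, le_div_iff₀ (by positivity)]
  nlinarith

/-- Lipschitz dependence of midpoints on their endpoints inside a
regular ball of a CAT(1) space, with constant depending only on `ρ`. -/
theorem midpoint_lipschitz_in_endpoints (ρ : ℝ) (hρ : ρ ∈ Set.Ioo 0 (Real.pi / 2)) :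
    ∃ c : ℝ, 0 < c ∧
      ∀ (Y : Type) [MetricSpace Y] [CompleteSpace Y], IsCAT 1 Y →
        ∀ (o : Y) (a b a' b' : Y),
          a ∈ Metric.closedBall o ρ → b ∈ Metric.closedBall o ρ →
          a' ∈ Metric.closedBall o ρ → b' ∈ Metric.closedBall o ρ →
          dist a a' < 2 * (Real.pi - 2 * ρ) → dist b b' < 2 * (Real.pi - 2 * ρ) →
          ∀ mid mid' : Y, IsGeodMidpoint a b mid → IsGeodMidpoint a' b' mid' →
            dist mid mid' ≤ c * (dist a a' + dist b b') := by
  have hcr : 0 < Real.cos ρ :=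
    Real.cos_pos_of_mem_Ioo ⟨by linarith [hρ.1, Real.pi_pos], hρ.2⟩
  refine ⟨Real.pi / (4 * Real.cos ρ), div_pos Real.pi_pos (by positivity), ?_⟩
  intro Y _ _ hY o a b a' b' ha hb ha' hb' haa hbb m m' hm hm'
  have hball : ∀ u v : Y, u ∈ Metric.closedBall o ρ → v ∈ Metric.closedBall o ρ →
      dist u v ≤ 2 * ρ := by
    intro u v hu hv
    have := dist_triangle_right u v o
    rw [Metric.mem_closedBall] at hu hv
    linarith
  obtain ⟨γ, hγ, h0, h1⟩ := hY.1 a' b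
  have hn : IsGeodMidpoint a' b (γ (1/2)) := ⟨γ, hγ, h0, h1, rfl⟩
  have e1 := mid_lip hY hρ (hball b a hb ha) (hball b a' hb ha') haa hm.symm' hn.symm'
  have e2 := mid_lip hY hρ (hball a' b ha' hb) (hball a' b' ha' hb') hbb hn hm'
  have := dist_triangle m (γ (1/2)) m'
  linarith


end KSH
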